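/- arXiv:2311.16366 — 7 statements merged into one kernel-verified Lean document; each statement's English description precedes it below -/
import Mathlib

section
/- Let L be a complex square matrix of size (N+1)d indexed by pairs (n, r) with n ∈ {0,…,N}, r ∈ {1,…,d}, regarded as an (N+1)×(N+1) matrix of d×d blocks. Suppose x_1, …, x_M are complex numbers and, for each k, Q_0(x_k), …, Q_N(x_k) are d×d matrices such that the block row vector Q(x_k) = (Q_0(x_k), …, Q_N(x_k)) satisfies Q(x_k)·L = −x_k·Q(x_k). Suppose further there are positive semidefinite d×d matrices W_1, …, W_M and invertible d×d matrices F_0, …, F_N with Σ_{k=1}^M Q_j*(x_k) W_k Q_m(x_k) = δ_{jm} F_j for all j, m ∈ {0,…,N}. Then for every t ≥ 0 and all i, j ∈ {0,…,N}, the (j,i) d×d block of exp(t L) equals F_j^{-1} Σ_{k=1}^M e^{-x_k t} Q_j*(x_k) W_k Q_i(x_k). -/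
open scoped ComplexOrder
open Matrix

/-- The matrix exponential `exp(A) = Σ_{k≥0} A^k / k!`. -/
noncomputable def matExp {m : Type*} [Fintype m] [DecidableEq m]
    (A : Matrix m m ℂ) : Matrix m m ℂ :=
  ∑' k : ℕ, ((k.factorial : ℂ)⁻¹) • A ^ k

/-- The `(n,m)` `d×d` block of a matrix indexed by pairs. -/
def blk {N d : ℕ} (L : Matrix (Fin N × Fin d) (Fin N × Fin d) ℂ) (n m : Fin N) :
    Matrix (Fin d) (Fin d) ℂ :=
  Matrix.of fun r s => L (n, r) (m, s)

theorem blk_mul_aux {N d : ℕ} (A B : Matrix (Fin N × Fin d) (Fin N × Fin d) ℂ) (n m : Fin N) :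
    blk (A * B) n m = ∑ l, blk A n l * blk B l m := by
  ext r s
  simp [blk, Matrix.mul_apply, Matrix.sum_apply, Fintype.sum_prod_type]

theorem row_pow_aux {N d : ℕ} (L : Matrix (Fin N × Fin d) (Fin N × Fin d) ℂ)
    (q : Fin N → Matrix (Fin d) (Fin d) ℂ) (c : ℂ)
    (h : ∀ i, ∑ n, q n * blk L n i = c • q i) (p : ℕ) :
    ∀ i, ∑ n, q n * blk (L ^ p) n i = c ^ p • q i := by
  induction p with
  | zero =>
    intro i
    have : ∀ n, blk (1 : Matrix (Fin N × Fin d) (Fin N × Fin d) ℂ) n i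
        = if n = i then 1 else 0 := by
      intro n
      ext r s
      by_cases hn : n = i <;> simp [blk, Matrix.one_apply, hn]
    simp [this]
  | succ p ih =>
    intro i
    simp only [pow_succ, blk_mul_aux, Finset.mul_sum]
    rw [Finset.sum_comm]
    simp only [← Matrix.mul_assoc, ← Finset.sum_mul, ih, smul_mul_assoc, ← Finset.smul_sum, h,
      smul_smul]

/-- **Karlin–McGregor formula for CTOQWs on a finite vertex set (equation (9)).**
Let `L` be a square matrix of `(N+1)×(N+1)` blocks of size `d×d`.  Suppose for each of
finitely many complex numbers `x k` the block row vector `(Q k 0, …, Q k N)` satisfies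
`Q(x_k)·L = -x_k·Q(x_k)`, and suppose there are positive semidefinite matrices `W k` and
invertible matrices `F j` with `Σ_k Q_j*(x_k) W_k Q_m(x_k) = δ_{jm} F_j`.  Then for every
`t ≥ 0` the `(j,i)` block of `exp(tL)` equals `F_j⁻¹ Σ_k e^{-x_k t} Q_j*(x_k) W_k Q_i(x_k)`. -/
theorem stmt5 (N d M : ℕ)
    (L : Matrix (Fin (N + 1) × Fin d) (Fin (N + 1) × Fin d) ℂ)
    (x : Fin M → ℂ)
    (Q : Fin M → Fin (N + 1) → Matrix (Fin d) (Fin d) ℂ)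
    (hrow : ∀ k : Fin M, ∀ i : Fin (N + 1),
      ∑ n : Fin (N + 1), Q k n * blk L n i = (-(x k)) • Q k i)
    (W : Fin M → Matrix (Fin d) (Fin d) ℂ)
    (hW : ∀ k, (W k).PosSemidef)
    (F : Fin (N + 1) → Matrix (Fin d) (Fin d) ℂ)
    (hF : ∀ j, IsUnit (F j))
    (horth : ∀ j m : Fin (N + 1),
      ∑ k : Fin M, (Q k j)ᴴ * W k * Q k m = if j = m then F j else 0) :
    ∀ t : ℝ, 0 ≤ t → ∀ i j : Fin (N + 1),
      blk (matExp ((t : ℂ) • L)) j i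
        = (F j)⁻¹ * ∑ k : Fin M, Complex.exp (-(x k * t)) • ((Q k j)ᴴ * W k * Q k i) := by
  intro t _ i j
  set A := (t : ℂ) • L with hA
  have hrowA : ∀ k i, ∑ n, Q k n * blk A n i = (-(x k * t)) • Q k i := by
    intro k i
    have : ∀ n, blk A n i = (t : ℂ) • blk L n i := by
      intro n; ext r s; simp [blk, hA]
    simp only [this, mul_smul_comm, ← Finset.smul_sum, hrow, smul_smul]
    congr 1; ring
  have hpow : ∀ p i j, blk (A ^ p) j i
      = (F j)⁻¹ * ∑ k, (-(x k * t)) ^ p • ((Q k j)ᴴ * W k * Q k i) := by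
    intro p i j
    have hdet : IsUnit (F j).det := (Matrix.isUnit_iff_isUnit_det _).mp (hF j)
    have key : F j * blk (A ^ p) j i
        = ∑ k, (-(x k * t)) ^ p • ((Q k j)ᴴ * W k * Q k i) := by
      have h1 : F j * blk (A ^ p) j i
          = ∑ n, (∑ k, (Q k j)ᴴ * W k * Q k n) * blk (A ^ p) n i := by
        simp [horth]
      rw [h1]
      simp only [Finset.sum_mul]
      rw [Finset.sum_comm]
      refine Finset.sum_congr rfl fun k _ => ?_
      simp only [Matrix.mul_assoc, ← Finset.mul_sum]
      rw [row_pow_aux A (Q k) _ (hrowA k) p i]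
      simp only [mul_smul_comm]
    rw [← key, Matrix.nonsing_inv_mul_cancel_left _ _ hdet]
  have hsum : HasSum (fun p : ℕ => ((p.factorial : ℂ)⁻¹) • A ^ p)
      (Matrix.of fun a b : Fin (N + 1) × Fin d =>
        ((F a.1)⁻¹ * ∑ k, Complex.exp (-(x k * t)) • ((Q k a.1)ᴴ * W k * Q k b.1)) a.2 b.2) := by
    refine Pi.hasSum.mpr fun a => Pi.hasSum.mpr fun b => ?_
    have hent : ∀ p : ℕ, (((p.factorial : ℂ)⁻¹) • A ^ p) a b
        = ∑ u, (F a.1)⁻¹ a.2 u * ∑ k, ((p.factorial : ℂ)⁻¹ • (-(x k * t)) ^ p)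
            * ((Q k a.1)ᴴ * W k * Q k b.1) u b.2 := by
      intro p
      have := congrFun (congrFun (hpow p b.1 a.1) a.2) b.2
      have h2 : (A ^ p) a b = blk (A ^ p) a.1 b.1 a.2 b.2 := rfl
      rw [Matrix.smul_apply, h2, this, Matrix.mul_apply, smul_eq_mul, Finset.mul_sum]
      refine Finset.sum_congr rfl fun u _ => ?_
      simp only [Matrix.sum_apply, Matrix.smul_apply, smul_eq_mul, Finset.mul_sum]
      refine Finset.sum_congr rfl fun k _ => ?_
      ring
    simp only [hent, Matrix.of_apply, Matrix.mul_apply (M := (F a.1)⁻¹), Matrix.sum_apply,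
      Matrix.smul_apply, smul_eq_mul]
    refine hasSum_sum fun u _ => HasSum.mul_left _ (hasSum_sum fun k _ => HasSum.mul_right _ ?_)
    have := NormedSpace.exp_series_hasSum_exp' (𝕂 := ℂ) (-(x k * t))
    rw [← Complex.exp_eq_exp_ℂ] at this
    simpa only [smul_eq_mul] using this
  unfold matExp
  rw [hsum.tsum_eq]
  rfl
end

section
/- Let G, K be d×d complex matrices with K invertible, and let J be the (N+1)(d)×(N+1)(d) block tridiagonal matrix whose diagonal blocks all equal G and whose sub- and super-diagonal blocks all equal K. Define matrix polynomials by Q_0(x) = I_d, Q_{-1}(x) = 0, and −x Q_n(x) = Q_{n+1}(x)K + Q_n(x)G + Q_{n-1}(x)K for 0 ≤ n ≤ N−1, and set R_{N+1}(x) := Q_N(x)(−x I_d − G) − Q_{N-1}(x)K. Then for every complex x, det(R_{N+1}(x)) = 0 if and only if x is an eigenvalue of −J. -/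
open Matrix

lemma aux_sum1 (N n : ℕ) (F : ℕ → ℂ) (h0 : F 0 = 0) (hn : n ≤ N + 1) :
    ∑ i : Fin (N + 1), (if (i : ℕ) + 1 = n then F (i + 1) else 0) = F n := by
  rw [Fin.sum_univ_eq_sum_range (fun i => if i + 1 = n then F (i + 1) else 0)]
  rcases n with _ | n
  · simp [h0]
  · rw [Finset.sum_eq_single n]
    · simp
    · intro b _ hb
      simp [hb]
    · intro h
      simp at h
      omega

lemma aux_sum2 (N n : ℕ) (F : ℕ → ℂ) (h0 : F (N + 2) = 0) (hn : n ≤ N) :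
    ∑ i : Fin (N + 1), (if n + 1 = (i : ℕ) then F (i + 1) else 0) = F (n + 2) := by
  rw [Fin.sum_univ_eq_sum_range (fun i => if n + 1 = i then F (i + 1) else 0)]
  rw [Finset.sum_ite_eq]
  split_ifs with h
  · rfl
  · simp at h
    have : n = N := by omega
    rw [this, h0]

lemma aux_key (d N : ℕ) (G K : Matrix (Fin d) (Fin d) ℂ)
    (J : Matrix (Fin (N + 1) × Fin d) (Fin (N + 1) × Fin d) ℂ)
    (hJ : ∀ p q : Fin (N + 1) × Fin d,
      J p q = if p.1 = q.1 then G p.2 q.2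
        else if ((p.1 : ℕ) + 1 = q.1 ∨ (q.1 : ℕ) + 1 = p.1) then K p.2 q.2 else 0)
    (w : ℕ → Fin d → ℂ) (h0 : w 0 = 0) (h2 : w (N + 2) = 0) (x : ℂ)
    (n : Fin (N + 1)) (j : Fin d) :
    ((fun p : Fin (N + 1) × Fin d => w (p.1 + 1) p.2) ᵥ*
      (x • (1 : Matrix (Fin (N + 1) × Fin d) (Fin (N + 1) × Fin d) ℂ) + J)) (n, j) =
    (x • w (n + 1) + w n ᵥ* K + w (n + 1) ᵥ* G + w (n + 2) ᵥ* K) j := by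
  rw [Matrix.vecMul_add, Matrix.vecMul_smul, Matrix.vecMul_one]
  have hn := n.2
  have e : ((fun p : Fin (N + 1) × Fin d => w (p.1 + 1) p.2) ᵥ* J) (n, j) =
      (w n ᵥ* K) j + (w (n + 1) ᵥ* G) j + (w (n + 2) ᵥ* K) j := by
    rw [← aux_sum1 N n (fun m => (w m ᵥ* K) j) (by simp [h0]) (by omega),
      ← aux_sum2 N n (fun m => (w m ᵥ* K) j) (by simp [h2]) (by omega)]
    have e3 : (w (n + 1) ᵥ* G) j =
        ∑ i : Fin (N + 1), if i = n then (w (i + 1) ᵥ* G) j else 0 := by simp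
    rw [e3, ← Finset.sum_add_distrib, ← Finset.sum_add_distrib]
    simp only [Matrix.vecMul, dotProduct, Fintype.sum_prod_type, hJ]
    refine Finset.sum_congr rfl fun i _ => ?_
    by_cases h : i = n
    · subst h
      simp
    · by_cases h1 : (i : ℕ) + 1 = n
      · have : ¬ ((n : ℕ) + 1 = i) := by omega
        simp [h, h1, this]
      · by_cases h3 : (n : ℕ) + 1 = i
        · simp [h, h1, h3]
        · simp [h, h1, h3]
  simp only [Pi.add_apply, Pi.smul_apply, e]
  ring



/-- **Section 6.1: zeros of `det R_{N+1}` are the eigenvalues of `-J`.**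
`J` is the `(N+1)×(N+1)` block tridiagonal matrix with all diagonal blocks `G` and all
off-diagonal (sub- and super-diagonal) blocks `K`, with `K` invertible.  The matrix
polynomials are encoded by `P : ℕ → ℂ → _` via `P n = Q_{n-1}`, so `P 0 = Q_{-1} = 0`,
`P 1 = Q_0 = I`, and the three-term recurrence
`-x Q_n(x) = Q_{n+1}(x)K + Q_n(x)G + Q_{n-1}(x)K` holds for `0 ≤ n ≤ N-1`.
With `R_{N+1}(x) = Q_N(x)(-xI - G) - Q_{N-1}(x)K`, one has
`det(R_{N+1}(x)) = 0 ↔ x ∈ spec(-J)`. -/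
theorem stmt6 (d N : ℕ) (hd : 0 < d)
    (G K : Matrix (Fin d) (Fin d) ℂ) (hK : IsUnit K)
    (J : Matrix (Fin (N + 1) × Fin d) (Fin (N + 1) × Fin d) ℂ)
    (hJ : ∀ p q : Fin (N + 1) × Fin d,
      J p q = if p.1 = q.1 then G p.2 q.2
        else if ((p.1 : ℕ) + 1 = q.1 ∨ (q.1 : ℕ) + 1 = p.1) then K p.2 q.2 else 0)
    (P : ℕ → ℂ → Matrix (Fin d) (Fin d) ℂ)
    (hP0 : ∀ x, P 0 x = 0)
    (hP1 : ∀ x, P 1 x = 1)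
    (hrec : ∀ x : ℂ, ∀ n : ℕ, n < N →
      (-x) • P (n + 1) x = P (n + 2) x * K + P (n + 1) x * G + P n x * K) :
    ∀ x : ℂ,
      (P (N + 1) x * ((-x) • (1 : Matrix (Fin d) (Fin d) ℂ) - G) - P N x * K).det = 0
        ↔ x ∈ spectrum ℂ (-J) := by
  intro x
  rw [spectrum.mem_iff, Matrix.isUnit_iff_isUnit_det, isUnit_iff_ne_zero, not_not,
    Algebra.algebraMap_eq_smul_one, sub_neg_eq_add, ← Matrix.exists_vecMul_eq_zero_iff,
    ← Matrix.exists_vecMul_eq_zero_iff]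
  have hR : ∀ u : Fin d → ℂ,
      u ᵥ* (P (N + 1) x * ((-x) • (1 : Matrix (Fin d) (Fin d) ℂ) - G) - P N x * K) =
      -(x • (u ᵥ* P (N + 1) x) + (u ᵥ* P N x) ᵥ* K + (u ᵥ* P (N + 1) x) ᵥ* G) := by
    intro u
    rw [Matrix.vecMul_sub, ← Matrix.vecMul_vecMul, ← Matrix.vecMul_vecMul, Matrix.vecMul_sub,
      Matrix.vecMul_smul, Matrix.vecMul_one, neg_smul]
    abel
  have hS : ∀ (u : Fin d → ℂ) (n : ℕ), n < N →
      x • (u ᵥ* P (n + 1) x) + (u ᵥ* P n x) ᵥ* K + (u ᵥ* P (n + 1) x) ᵥ* G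
        + (u ᵥ* P (n + 2) x) ᵥ* K = 0 := by
    intro u n hn
    have h := congrArg (fun M => u ᵥ* M) (hrec x n hn)
    simp only [Matrix.vecMul_add, Matrix.vecMul_smul, ← Matrix.vecMul_vecMul, neg_smul, Matrix.vecMul_neg] at h
    rw [neg_eq_iff_add_eq_zero] at h
    rw [← h]
    abel
  constructor
  · rintro ⟨u, hu, hu0⟩
    rw [hR, neg_eq_zero] at hu0
    let w : ℕ → Fin d → ℂ := fun n => if n ≤ N + 1 then u ᵥ* P n x else 0
    have hw : ∀ n, n ≤ N + 1 → w n = u ᵥ* P n x := fun n hn => if_pos hn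
    have hw2 : w (N + 2) = 0 := if_neg (by omega)
    refine ⟨fun p => w (p.1 + 1) p.2, ?_, ?_⟩
    · intro h
      apply hu
      ext j
      have := congrFun h (0, j)
      simpa [hw 1 (by omega), hP1] using this
    · ext ⟨n, j⟩
      have hn := n.2
      rw [aux_key d N G K J hJ w (by rw [hw 0 (by omega), hP0]; simp) hw2 x n j]
      rw [hw (n + 1) (by omega), hw n (by omega)]
      by_cases h : (n : ℕ) < N
      · rw [hw (n + 2) (by omega), hS u n h]
        rfl
      · have h' : (n : ℕ) = N := by omega
        rw [h', hw2, hu0]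
        simp
  · rintro ⟨v, hv, hv0⟩
    let w : ℕ → Fin d → ℂ := fun n =>
      if h : 1 ≤ n ∧ n ≤ N + 1 then fun j => v (⟨n - 1, by omega⟩, j) else 0
    have hw0 : w 0 = 0 := dif_neg (by omega)
    have hw2 : w (N + 2) = 0 := dif_neg (by omega)
    have hvw : v = fun p : Fin (N + 1) × Fin d => w (p.1 + 1) p.2 := by
      ext ⟨n, j⟩
      have hn := n.2
      have : w (n + 1) = fun j => v (n, j) := by
        simp only [w]
        rw [dif_pos (by omega)]
        simp
      simp [this]
    have hrow : ∀ n : ℕ, n ≤ N →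
        x • w (n + 1) + w n ᵥ* K + w (n + 1) ᵥ* G + w (n + 2) ᵥ* K = 0 := by
      intro n hn
      ext j
      have := aux_key d N G K J hJ w hw0 hw2 x ⟨n, by omega⟩ j
      rw [← hvw, hv0] at this
      exact this.symm
    have hind : ∀ n : ℕ, n ≤ N → w n = w 1 ᵥ* P n x ∧ w (n + 1) = w 1 ᵥ* P (n + 1) x := by
      intro n
      induction n with
      | zero => intro _; simp [hw0, hP0, hP1]
      | succ n ih =>
        intro hn
        obtain ⟨a, b⟩ := ih (by omega)
        refine ⟨b, ?_⟩
        have h1 := hrow n (by omega)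
        have h2 := hS (w 1) n (by omega)
        rw [← a, ← b] at h2
        exact Matrix.vecMul_injective_of_isUnit hK (add_left_cancel (h1.trans h2.symm))
    refine ⟨w 1, ?_, ?_⟩
    · intro h
      apply hv
      rw [hvw]
      ext ⟨n, j⟩
      have hn := n.2
      simp [(hind n (by omega)).2, h]
    · rw [hR, ← (hind N le_rfl).1, ← (hind N le_rfl).2, neg_eq_zero]
      simpa [hw2] using hrow N le_rfl
end

section
/- Let d ≥ 1, let H be a Hermitian d×d complex matrix, let A, B, C be d×d complex matrices, set S := ½(A*A + B*B + C*C), ⌈B⌉ := B ⊗ B̄ (Kronecker product with the entrywise conjugate), and T := (−iH − S) ⊗ I_d + I_d ⊗ (i H̄ − S̄) + B ⊗ B̄. Then T is Hermitian and negative semidefinite if and only if there exists an orthonormal basis of ℂ^{d²} in which, writing h_{jk} for the entries of −H ⊗ I_d + I_d ⊗ H̄, writing a_{jk} + i b_{jk} (a_{jk}, b_{jk} real) for the entries of B ⊗ B̄, and s_{jk} for the entries of S ⊗ I_d + I_d ⊗ S̄, one has h_{kk} = −b_{kk} for all k and h_{jk} = −i( s_{jk} − a_{jk} − i b_{jk}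 ) for all j ≠ k. -/
open Matrix Kronecker
open scoped ComplexOrder

/-- Entrywise complex conjugate of a matrix. -/
noncomputable def conjM {m n : Type*} (X : Matrix m n ℂ) : Matrix m n ℂ :=
  X.map (starRingEnd ℂ)

/-- The `(j,k)` entry of the matrix `M` in the basis `v`. -/
noncomputable def entIn {ι : Type*} [Fintype ι] (v : ι → ι → ℂ) (M : Matrix ι ι ℂ) (j k : ι) : ℂ :=
  star (v j) ⬝ᵥ (M *ᵥ v k)


theorem aux_entIn {ι : Type*} [Fintype ι] (v : ι → ι → ℂ) (M : Matrix ι ι ℂ) (j k : ι) :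
    entIn v M j k = ((Matrix.of v)ᵀᴴ * M * (Matrix.of v)ᵀ) j k := by
  rw [Matrix.mul_assoc]
  simp only [entIn, Matrix.mul_apply, dotProduct, Matrix.mulVec]
  rfl

theorem aux_conjH {n : Type*} (X : Matrix n n ℂ) : (conjM X)ᴴ = Xᵀ := by
  ext i j; simp [conjM]

theorem aux_psd {n : Type*} [Fintype n] [DecidableEq n] (A : Matrix n n ℂ) :
    ((Aᴴ * A) ⊗ₖ (1 : Matrix n n ℂ) + (1 : Matrix n n ℂ) ⊗ₖ conjM (Aᴴ * A)).PosSemidef := by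
  have h : conjM (Aᴴ * A) = (conjM A)ᴴ * conjM A := by
    ext i j; simp [conjM, Matrix.mul_apply]
  rw [h]
  exact ((posSemidef_conjTranspose_mul_self A).kronecker PosSemidef.one).add
    (PosSemidef.one.kronecker (posSemidef_conjTranspose_mul_self _))

theorem aux_main {n : Type*} [Fintype n] [DecidableEq n]
    (H A B C : Matrix n n ℂ) (hH : H.IsHermitian)
    (S : Matrix n n ℂ)
    (hS : S = ((2 : ℂ))⁻¹ • (Aᴴ * A + Bᴴ * B + Cᴴ * C))
    (T : Matrix (n × n) (n × n) ℂ)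
    (hT : T = ((-Complex.I) • H - S) ⊗ₖ (1 : Matrix n n ℂ)
        + (1 : Matrix n n ℂ) ⊗ₖ (Complex.I • conjM H - conjM S)
        + B ⊗ₖ conjM B) (hTH : T.IsHermitian) : (-T).PosSemidef := by
  have hSH : S.IsHermitian := by
    rw [hS]
    simp [Matrix.IsHermitian, conjTranspose_smul, conjTranspose_add, conjTranspose_mul]
  have hH' : ∀ i j, (starRingEnd ℂ) (H i j) = H j i := fun i j => hH.apply j i
  have hS' : ∀ i j, (starRingEnd ℂ) (S i j) = S j i := fun i j => hSH.apply j i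
  have hN : B * Bᴴ = Bᴴ * B := by
    ext i j
    have h1 : ∑ k, T (i, j) (k, k) = ∑ k, Tᴴ (i, j) (k, k) := by rw [hTH.eq]
    simp only [hT, Matrix.conjTranspose_apply, Matrix.add_apply, Matrix.sub_apply,
      Matrix.smul_apply, Matrix.kroneckerMap_apply, Matrix.one_apply, conjM, Matrix.map_apply,
      hH', hS', Finset.sum_add_distrib, star_add, star_mul', star_sub, smul_eq_mul, mul_ite,
      ite_mul, mul_one, mul_zero, one_mul, zero_mul, Finset.sum_ite_eq, Finset.sum_ite_eq',
      Finset.mem_univ, if_true, apply_ite star, star_one, star_zero, RCLike.star_def,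
      Complex.conj_conj, map_neg, Complex.conj_I] at h1
    simp only [Matrix.mul_apply, Matrix.conjTranspose_apply, RCLike.star_def]
    linear_combination h1
  have hTT : -T = ((2:ℂ))⁻¹ • (-T + -Tᴴ) := by
    rw [hTH.eq, ← two_smul ℂ (-T), smul_smul]; norm_num
  have key : -T + -Tᴴ = ((Aᴴ * A) ⊗ₖ (1 : Matrix n n ℂ) + (1 : Matrix n n ℂ) ⊗ₖ conjM (Aᴴ * A))
      + ((Cᴴ * C) ⊗ₖ (1 : Matrix n n ℂ) + (1 : Matrix n n ℂ) ⊗ₖ conjM (Cᴴ * C))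
      + (Bᴴ ⊗ₖ (1 : Matrix n n ℂ) - (1 : Matrix n n ℂ) ⊗ₖ conjM B)ᴴ
        * (Bᴴ ⊗ₖ (1 : Matrix n n ℂ) - (1 : Matrix n n ℂ) ⊗ₖ conjM B) := by
    have e1 : (Bᴴ ⊗ₖ (1 : Matrix n n ℂ) - (1 : Matrix n n ℂ) ⊗ₖ conjM B)ᴴ
        * (Bᴴ ⊗ₖ (1 : Matrix n n ℂ) - (1 : Matrix n n ℂ) ⊗ₖ conjM B)
        = (Bᴴ * B) ⊗ₖ (1 : Matrix n n ℂ) + (1 : Matrix n n ℂ) ⊗ₖ conjM (Bᴴ * B)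
          - B ⊗ₖ conjM B - Bᴴ ⊗ₖ Bᵀ := by
      have h : conjM (Bᴴ * B) = Bᵀ * conjM B := by
        ext i j; simp [conjM, Matrix.mul_apply]
      rw [conjTranspose_sub, conjTranspose_kronecker, conjTranspose_kronecker, aux_conjH,
        conjTranspose_conjTranspose, conjTranspose_one, sub_mul, mul_sub, mul_sub,
        ← mul_kronecker_mul, ← mul_kronecker_mul, ← mul_kronecker_mul, ← mul_kronecker_mul, hN, h]
      simp only [Matrix.one_mul, Matrix.mul_one]
      abel
    have e2 : Aᴴ * A + Bᴴ * B + Cᴴ * C = (2:ℂ) • S := by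
      rw [hS, smul_smul]; norm_num
    have e3 : Aᴴ * A = (2:ℂ) • S - Bᴴ * B - Cᴴ * C := by rw [← e2]; abel
    rw [e1, e3, hT]
    ext ⟨i, j⟩ ⟨k, l⟩
    simp only [Matrix.conjTranspose_apply, Matrix.add_apply, Matrix.sub_apply, Matrix.neg_apply,
      Matrix.smul_apply, Matrix.kroneckerMap_apply, conjM, Matrix.map_apply, Matrix.transpose_apply,
      hH', hS', star_add, star_mul', star_sub, smul_eq_mul, RCLike.star_def, map_sub, map_mul,
      Complex.conj_conj, map_neg, Complex.conj_I, map_ofNat]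
    have o : ∀ a b : n, (starRingEnd ℂ) ((1 : Matrix n n ℂ) a b) = (1 : Matrix n n ℂ) b a := by
      intro a b
      simp [Matrix.one_apply, apply_ite (starRingEnd ℂ), eq_comm]
    have o' : ∀ a b : n, ((1 : Matrix n n ℂ) a b) = (1 : Matrix n n ℂ) b a := by
      intro a b
      simp [Matrix.one_apply, eq_comm]
    simp only [o, o' k i, o' l j]
    ring
  rw [hTT, key]
  refine PosSemidef.smul (((aux_psd A).add (aux_psd C)).add
    (posSemidef_conjTranspose_mul_self _)) ?_
  rw [inv_nonneg]
  exact zero_le_two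

/-- **Proposition 5.2.**  With `S = ½(A*A + B*B + C*C)` and
`T = (−iH − S) ⊗ I + I ⊗ (iH̄ − S̄) + B ⊗ B̄`, the matrix `T` is Hermitian and negative
semidefinite if and only if there exists an orthonormal basis of `ℂ^{d²}` in which,
writing `h_{jk}` for the entries of `−H ⊗ I + I ⊗ H̄`, `a_{jk} + i b_{jk}` for the entries
of `B ⊗ B̄`, and `s_{jk}` for the entries of `S ⊗ I + I ⊗ S̄`, one has `h_{kk} = −b_{kk}`
for all `k` and `h_{jk} = −i(s_{jk} − a_{jk} − i b_{jk})` for all `j ≠ k`. -/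
theorem stmt10 (d : ℕ) (hd : 1 ≤ d)
    (H A B C : Matrix (Fin d) (Fin d) ℂ) (hH : H.IsHermitian)
    (S : Matrix (Fin d) (Fin d) ℂ)
    (hS : S = ((2 : ℂ))⁻¹ • (Aᴴ * A + Bᴴ * B + Cᴴ * C))
    (T : Matrix (Fin d × Fin d) (Fin d × Fin d) ℂ)
    (hT : T = ((-Complex.I) • H - S) ⊗ₖ (1 : Matrix (Fin d) (Fin d) ℂ)
        + (1 : Matrix (Fin d) (Fin d) ℂ) ⊗ₖ (Complex.I • conjM H - conjM S)
        + B ⊗ₖ conjM B) :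
    (-T).PosSemidef ↔
      ∃ v : (Fin d × Fin d) → ((Fin d × Fin d) → ℂ),
        (∀ j k, star (v j) ⬝ᵥ v k = if j = k then (1 : ℂ) else 0)
        ∧ (∀ k, entIn v ((-H) ⊗ₖ (1 : Matrix (Fin d) (Fin d) ℂ)
              + (1 : Matrix (Fin d) (Fin d) ℂ) ⊗ₖ conjM H) k k
            = -(((entIn v (B ⊗ₖ conjM B) k k).im : ℂ)))
        ∧ (∀ j k, j ≠ k →
            entIn v ((-H) ⊗ₖ (1 : Matrix (Fin d) (Fin d) ℂ)
                + (1 : Matrix (Fin d) (Fin d) ℂ) ⊗ₖ conjM H) j k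
              = -Complex.I *
                  (entIn v (S ⊗ₖ (1 : Matrix (Fin d) (Fin d) ℂ)
                      + (1 : Matrix (Fin d) (Fin d) ℂ) ⊗ₖ conjM S) j k
                    - ((entIn v (B ⊗ₖ conjM B) j k).re : ℂ)
                    - Complex.I * ((entIn v (B ⊗ₖ conjM B) j k).im : ℂ))) := by
  have hSH : S.IsHermitian := by
    rw [hS]
    simp [Matrix.IsHermitian, conjTranspose_smul, conjTranspose_add, conjTranspose_mul]
  have cH : ∀ X : Matrix (Fin d) (Fin d) ℂ, X.IsHermitian → (conjM X).IsHermitian := by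
    intro X hX
    ext i j
    simp only [conjM, conjTranspose_apply, map_apply, ← hX.apply i j]
    simp
  have o1 : (1 : Matrix (Fin d) (Fin d) ℂ)ᴴ = 1 := conjTranspose_one
  set P := (-H) ⊗ₖ (1 : Matrix (Fin d) (Fin d) ℂ)
              + (1 : Matrix (Fin d) (Fin d) ℂ) ⊗ₖ conjM H with hP
  set Q := S ⊗ₖ (1 : Matrix (Fin d) (Fin d) ℂ)
                      + (1 : Matrix (Fin d) (Fin d) ℂ) ⊗ₖ conjM S with hQ
  set R := B ⊗ₖ conjM B with hR
  have hPH : P.IsHermitian := by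
    rw [Matrix.IsHermitian, hP, conjTranspose_add, conjTranspose_kronecker,
      conjTranspose_kronecker, o1, conjTranspose_neg, hH.eq, (cH H hH).eq]
  have hQH : Q.IsHermitian := by
    rw [Matrix.IsHermitian, hQ, conjTranspose_add, conjTranspose_kronecker,
      conjTranspose_kronecker, o1, hSH.eq, (cH S hSH).eq]
  have hTP : T = Complex.I • P - Q + R := by
    rw [hT, hP, hQ]
    ext ⟨i, j⟩ ⟨k, l⟩
    simp only [Matrix.add_apply, Matrix.sub_apply, Matrix.neg_apply,
      Matrix.smul_apply, Matrix.kroneckerMap_apply, smul_eq_mul]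
    ring
  have eT : ∀ v j k, entIn v T j k = Complex.I * entIn v P j k - entIn v Q j k + entIn v R j k := by
    intro v j k
    rw [hTP]
    simp only [entIn, add_mulVec, sub_mulVec, smul_mulVec, dotProduct_add, dotProduct_sub,
      dotProduct_smul, smul_eq_mul]
  have eH : ∀ (M : Matrix (Fin d × Fin d) (Fin d × Fin d) ℂ), M.IsHermitian →
      ∀ v k, (entIn v M k k).im = 0 := by
    intro M hM v k
    rw [aux_entIn]
    have := (isHermitian_conjTranspose_mul_mul (Matrix.of v)ᵀ hM).apply k k
    exact Complex.conj_eq_iff_im.mp this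
  constructor
  · intro h
    have hTH : T.IsHermitian := by simpa using h.1.neg
    refine ⟨fun k => (hTH.eigenvectorBasis k).ofLp, ?_, ?_, ?_⟩
    · intro j k
      have := orthonormal_iff_ite.mp hTH.eigenvectorBasis.orthonormal j k
      rw [← this, EuclideanSpace.inner_eq_star_dotProduct, dotProduct_comm]
    · intro k
      have h1 := eT (fun k => (hTH.eigenvectorBasis k).ofLp) k k
      have hp := eH P hPH (fun k => (hTH.eigenvectorBasis k).ofLp) k
      have hq := eH Q hQH (fun k => (hTH.eigenvectorBasis k).ofLp) k
      have ht := eH T hTH (fun k => (hTH.eigenvectorBasis k).ofLp) k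
      rw [h1] at ht
      simp only [Complex.add_im, Complex.sub_im, Complex.mul_im, Complex.I_re, Complex.I_im] at ht
      apply Complex.ext
      · simp only [Complex.neg_re, Complex.ofReal_re]; linarith
      · simp only [Complex.neg_im, Complex.ofReal_im]; linarith
    · intro j k hjk
      have h1 := eT (fun k => (hTH.eigenvectorBasis k).ofLp) j k
      have h0 : entIn (fun k => (hTH.eigenvectorBasis k).ofLp) T j k = 0 := by
        have := orthonormal_iff_ite.mp hTH.eigenvectorBasis.orthonormal j k
        rw [EuclideanSpace.inner_eq_star_dotProduct, dotProduct_comm, if_neg hjk] at this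
        simp only [entIn]
        rw [hTH.mulVec_eigenvectorBasis, dotProduct_smul, this, smul_zero]
      rw [h0] at h1
      have h2 := Complex.re_add_im (entIn (fun k => (hTH.eigenvectorBasis k).ofLp) R j k)
      linear_combination Complex.I * h1 - Complex.I * h2
        + (entIn (fun k => (hTH.eigenvectorBasis k).ofLp) P j k) * Complex.I_mul_I
  · rintro ⟨v, hv, hd1, hd2⟩
    refine aux_main H A B C hH S hS T hT ?_
    set U := (Matrix.of v)ᵀ with hU
    have hUU : Uᴴ * U = 1 := by
      ext j k
      rw [Matrix.one_apply, ← hv j k]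
      rfl
    have hUU' : U * Uᴴ = 1 := mul_eq_one_comm.mp hUU
    have hD : (Uᴴ * T * U).IsHermitian := by
      ext j k
      rw [conjTranspose_apply, ← aux_entIn, ← aux_entIn]
      by_cases hjk : j = k
      · subst hjk
        apply Complex.conj_eq_iff_im.mpr
        rw [eT, hd1]
        have hq := eH Q hQH v j
        simp [hq]
      · have z : ∀ j k, j ≠ k → entIn v T j k = 0 := by
          intro j k hjk
          rw [eT, hd2 j k hjk]
          have h2 := Complex.re_add_im (entIn v R j k)
          linear_combination -h2 - (entIn v Q j k - (entIn v R j k).re - Complex.I * (entIn v R j k).im) * Complex.I_mul_I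
        rw [z j k hjk, z k j (Ne.symm hjk), star_zero]
    have h3 := isHermitian_mul_mul_conjTranspose U hD
    have h4 : U * (Uᴴ * T * U) * Uᴴ = T := by
      calc U * (Uᴴ * T * U) * Uᴴ = (U * Uᴴ) * T * (U * Uᴴ) := by simp only [Matrix.mul_assoc]
        _ = T := by rw [hUU', Matrix.one_mul, Matrix.mul_one]
    rwa [h4] at h3
end

section
/- Let d ≥ 1, H a Hermitian d×d complex matrix, A, B, C d×d complex matrices, S := ½(A*A + B*B + C*C). Assume there is an orthonormal basis of ℂ^{d²} in which the entries h_{jk} of −H ⊗ I_d + I_d ⊗ H̄, the entries a_{jk} + i b_{jk} (a, b real) of B ⊗ B̄, and the entries s_{jk} of S ⊗ I_d + I_d ⊗ S̄ satisfy h_{kk} = −b_{kk} and h_{jk} = −i(s_{jk} − a_{jk} − i b_{jk}) for j ≠ k. Then −H ⊗ I_d + I_d ⊗ H̄ is a real multiple of the identity matrix I_{d²} if and only if B ⊗ B̄ is Hermitian. -/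
open Matrix Kronecker

open Matrix Kronecker

theorem entIn_eq_conj {ι : Type*} [Fintype ι] (v : ι → ι → ℂ) (M : Matrix ι ι ℂ) (j k : ι) :
    entIn v M j k = (((Matrix.of v)ᵀ)ᴴ * M * (Matrix.of v)ᵀ) j k := by
  rw [Matrix.mul_assoc, Matrix.mul_apply]
  simp [entIn, dotProduct, Matrix.mulVec, Matrix.mul_apply]

theorem core_aux {ι : Type*} [Fintype ι] [DecidableEq ι] [Nonempty ι] (K T M : Matrix ι ι ℂ)
    (hK : K.IsHermitian) (hT : T.IsHermitian) (htr : K.trace = 0)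
    (hdiag : ∀ k, K k k = -((M k k).im : ℂ))
    (hoff : ∀ j k, j ≠ k → K j k = -Complex.I * (T j k - M j k)) :
    (∃ c : ℝ, K = (c : ℂ) • (1 : Matrix ι ι ℂ)) ↔ M.IsHermitian := by
  constructor
  · rintro ⟨c, rfl⟩
    have hc : c = 0 := by
      rw [Matrix.trace_smul, Matrix.trace_one] at htr
      simpa using htr
    subst hc
    have h1 : ∀ j k, j ≠ k → M j k = T j k := by
      intro j k hjk
      have := hoff j k hjk
      simp [sub_eq_zero] at this
      exact this.symm
    ext j k
    rw [Matrix.conjTranspose_apply]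
    by_cases hjk : j = k
    · subst hjk
      have := hdiag j
      simp at this
      apply Complex.ext <;> simp [this]
    · rw [h1 j k hjk, h1 k j (Ne.symm hjk)]
      exact hT.apply j k
  · intro hM
    refine ⟨0, ?_⟩
    ext j k
    by_cases hjk : j = k
    · subst hjk
      have h1 := congrArg Complex.im (hM.apply j j)
      simp at h1
      have h2 : (M j j).im = 0 := by linarith
      rw [hdiag j, h2]; simp
    · have h1 := hoff j k hjk
      have h2 := hoff k j (Ne.symm hjk)
      have h3 := hK.apply j k
      rw [h2] at h3
      rw [star_mul', star_neg, star_sub, hT.apply, hM.apply] at h3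
      simp at h3
      have h4 : K j k = 0 := by linear_combination (h1 - h3) / 2
      simp [h4]

theorem conjM_herm {m : Type*} (X : Matrix m m ℂ) (h : X.IsHermitian) : (conjM X).IsHermitian := by
  ext i j
  have := congrArg star (h.apply i j)
  simpa [conjM] using this

theorem kron_herm {m : Type*} (X Y : Matrix m m ℂ) (hX : X.IsHermitian)
    (hY : Y.IsHermitian) : (X ⊗ₖ Y).IsHermitian := by
  rw [Matrix.IsHermitian, Matrix.conjTranspose_kronecker, hX.eq, hY.eq]

/-- **Corollary to Proposition 5.2.**  With `S = ½(A*A + B*B + C*C)`, assume there is an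
orthonormal basis of `ℂ^{d²}` in which the entries `h_{jk}` of `−H ⊗ I + I ⊗ H̄`, the
entries `a_{jk} + i b_{jk}` of `B ⊗ B̄`, and the entries `s_{jk}` of `S ⊗ I + I ⊗ S̄`
satisfy `h_{kk} = −b_{kk}` and `h_{jk} = −i(s_{jk} − a_{jk} − i b_{jk})` for `j ≠ k`.
Then `−H ⊗ I + I ⊗ H̄` is a real multiple of the identity if and only if `B ⊗ B̄` is
Hermitian. -/
theorem stmt11 (d : ℕ) (hd : 1 ≤ d)
    (H A B C : Matrix (Fin d) (Fin d) ℂ) (hH : H.IsHermitian)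
    (S : Matrix (Fin d) (Fin d) ℂ)
    (hS : S = ((2 : ℂ))⁻¹ • (Aᴴ * A + Bᴴ * B + Cᴴ * C))
    (v : (Fin d × Fin d) → ((Fin d × Fin d) → ℂ))
    (hv : ∀ j k, star (v j) ⬝ᵥ v k = if j = k then (1 : ℂ) else 0)
    (hdiag : ∀ k, entIn v ((-H) ⊗ₖ (1 : Matrix (Fin d) (Fin d) ℂ)
          + (1 : Matrix (Fin d) (Fin d) ℂ) ⊗ₖ conjM H) k k
        = -(((entIn v (B ⊗ₖ conjM B) k k).im : ℂ)))
    (hoff : ∀ j k, j ≠ k →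
        entIn v ((-H) ⊗ₖ (1 : Matrix (Fin d) (Fin d) ℂ)
            + (1 : Matrix (Fin d) (Fin d) ℂ) ⊗ₖ conjM H) j k
          = -Complex.I *
              (entIn v (S ⊗ₖ (1 : Matrix (Fin d) (Fin d) ℂ)
                  + (1 : Matrix (Fin d) (Fin d) ℂ) ⊗ₖ conjM S) j k
                - ((entIn v (B ⊗ₖ conjM B) j k).re : ℂ)
                - Complex.I * ((entIn v (B ⊗ₖ conjM B) j k).im : ℂ))) :
    (∃ c : ℝ, (-H) ⊗ₖ (1 : Matrix (Fin d) (Fin d) ℂ)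
          + (1 : Matrix (Fin d) (Fin d) ℂ) ⊗ₖ conjM H
        = (c : ℂ) • (1 : Matrix (Fin d × Fin d) (Fin d × Fin d) ℂ))
      ↔ (B ⊗ₖ conjM B).IsHermitian := by
  haveI : Nonempty (Fin d × Fin d) := ⟨(⟨0, hd⟩, ⟨0, hd⟩)⟩
  have hS' : S.IsHermitian := by
    rw [hS, Matrix.IsHermitian]
    simp [Matrix.conjTranspose_smul]
  have hone : (1 : Matrix (Fin d) (Fin d) ℂ).IsHermitian := Matrix.isHermitian_one
  have hK := (kron_herm _ _ hH.neg hone).add (kron_herm _ _ hone (conjM_herm H hH))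
  have hT := (kron_herm _ _ hS' hone).add (kron_herm _ _ hone (conjM_herm S hS'))
  have htr : ((-H) ⊗ₖ (1 : Matrix (Fin d) (Fin d) ℂ)
          + (1 : Matrix (Fin d) (Fin d) ℂ) ⊗ₖ conjM H).trace = 0 := by
    have h1 : (conjM H).trace = H.trace := by
      have : conjM H = Hᵀ := by
        ext i j
        simpa [conjM] using hH.apply j i
      rw [this, Matrix.trace_transpose]
    rw [Matrix.trace_add, Matrix.trace_kronecker, Matrix.trace_kronecker, h1, Matrix.trace_neg]
    ring
  generalize (-H) ⊗ₖ (1 : Matrix (Fin d) (Fin d) ℂ)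
          + (1 : Matrix (Fin d) (Fin d) ℂ) ⊗ₖ conjM H = K at *
  generalize S ⊗ₖ (1 : Matrix (Fin d) (Fin d) ℂ)
          + (1 : Matrix (Fin d) (Fin d) ℂ) ⊗ₖ conjM S = T at *
  generalize B ⊗ₖ conjM B = M at *
  simp only [entIn_eq_conj] at hdiag hoff
  have hU : ((Matrix.of v)ᵀ)ᴴ * (Matrix.of v)ᵀ = 1 := by
    ext j k
    rw [Matrix.one_apply, ← hv j k]
    simp [Matrix.mul_apply, dotProduct]
  generalize (Matrix.of v)ᵀ = U at *
  have hU' : U * Uᴴ = 1 := mul_eq_one_comm.mp hU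
  have hback : ∀ X : Matrix (Fin d × Fin d) (Fin d × Fin d) ℂ, U * (Uᴴ * X * U) * Uᴴ = X := by
    intro X
    calc U * (Uᴴ * X * U) * Uᴴ = (U * Uᴴ) * X * (U * Uᴴ) := by simp only [Matrix.mul_assoc]
      _ = X := by rw [hU']; simp
  have key := core_aux (Uᴴ * K * U) (Uᴴ * T * U) (Uᴴ * M * U)
    (Matrix.isHermitian_conjTranspose_mul_mul U hK)
    (Matrix.isHermitian_conjTranspose_mul_mul U hT)
    (by rw [Matrix.trace_mul_comm, ← Matrix.mul_assoc, hU', Matrix.one_mul, htr])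
    hdiag
    (by
      intro j k hjk
      rw [hoff j k hjk]
      congr 1
      rw [sub_sub]
      congr 1
      rw [mul_comm Complex.I]
      exact Complex.re_add_im _)
  have e1 : (∃ c : ℝ, K = (c : ℂ) • (1 : Matrix (Fin d × Fin d) (Fin d × Fin d) ℂ)) ↔
      ∃ c : ℝ, Uᴴ * K * U = (c : ℂ) • (1 : Matrix (Fin d × Fin d) (Fin d × Fin d) ℂ) := by
    refine exists_congr fun c => ⟨fun h => ?_, fun h => ?_⟩
    · rw [h]; simp [hU]
    · rw [← hback K, h]; simp [hU']
  rw [e1, key]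
  refine ⟨fun h => ?_, fun h => Matrix.isHermitian_conjTranspose_mul_mul U h⟩
  rw [← hback M]
  exact Matrix.isHermitian_mul_mul_conjTranspose U h
end

section
/- Let d ≥ 1 and suppose given families of d²×d² complex matrices (A_n)_{n∈ℤ}, (C_n)_{n∈ℤ}, (T_n)_{n∈ℤ}, invertible matrices (R_n)_{n∈ℤ}, and Hermitian matrices (E_n)_{n∈ℤ} satisfying A_n* R_{n+1}* R_{n+1} = R_n* R_n C_{n+1} for n ≥ 0, R_{−n−1}* R_{−n−1} C_{−n} = A_{−n−1}* R_{−n}* R_{−n} for n ≥ 0, and R_n T_n = E_n R_n for all n ∈ ℤ. Define the 2d²×2d² matrices M_n = diag(A_n, C_{−n−1}) and N_{n+1} = diag(C_{n+1}, A_{−n−2}) for n ≥ 0, D_0 = [[T_0, A_{−1}],[C_0, T_{−1}]], D_n = diag(T_n, T_{−n−1}) for n ≥ 1, R̆_n = diag(R_n, R_{−n−1}) for n ≥ 0, Ĕ_0 = [[E_0, R_0 A_{−1} R_{−1}^{-1}],[R_{−1} C_0 R_0^{-1}, E_{−1}]], and Ĕ_n = diag(E_n, E_{−n−1}) for n ≥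 1. Then for all n ≥ 0: M_n* R̆_{n+1}* R̆_{n+1} = R̆_n* R̆_n N_{n+1} and R̆_n D_n = Ĕ_n R̆_n, each R̆_n is invertible, and each Ĕ_n is Hermitian. -/
open Matrix

/-- **Section 5: folding of the symmetrization data.**
Given `d²×d²` matrices `(A_n)`, `(C_n)`, `(T_n)` (`n ∈ ℤ`), invertible `(R_n)` and
Hermitian `(E_n)` with `A_n* R_{n+1}* R_{n+1} = R_n* R_n C_{n+1}` (`n ≥ 0`),
`R_{−n−1}* R_{−n−1} C_{−n} = A_{−n−1}* R_{−n}* R_{−n}` (`n ≥ 0`) and `R_n T_n = E_n R_n`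
(`n ∈ ℤ`), the folded matrices
`M_n = diag(A_n, C_{−n−1})`, `N_{n+1} = diag(C_{n+1}, A_{−n−2})`,
`D_0 = [[T_0, A_{−1}],[C_0, T_{−1}]]`, `D_n = diag(T_n, T_{−n−1})` (`n ≥ 1`),
`R̆_n = diag(R_n, R_{−n−1})`, `Ĕ_0 = [[E_0, R_0 A_{−1} R_{−1}⁻¹],[R_{−1} C_0 R_0⁻¹, E_{−1}]]`,
`Ĕ_n = diag(E_n, E_{−n−1})` (`n ≥ 1`) satisfy, for all `n ≥ 0`:
`M_n* R̆_{n+1}* R̆_{n+1} = R̆_n* R̆_n N_{n+1}` and `R̆_n D_n = Ĕ_n R̆_n`, every `R̆_n` is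
invertible, and every `Ĕ_n` is Hermitian. -/
theorem stmt13 (d : ℕ) (hd : 1 ≤ d)
    (A C T R E : ℤ → Matrix (Fin (d ^ 2)) (Fin (d ^ 2)) ℂ)
    (hR : ∀ n : ℤ, IsUnit (R n))
    (hE : ∀ n : ℤ, (E n).IsHermitian)
    (h1 : ∀ n : ℕ, (A n)ᴴ * (R ((n : ℤ) + 1))ᴴ * R ((n : ℤ) + 1)
        = (R n)ᴴ * R n * C ((n : ℤ) + 1))
    (h2 : ∀ n : ℕ, (R (-(n : ℤ) - 1))ᴴ * R (-(n : ℤ) - 1) * C (-(n : ℤ))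
        = (A (-(n : ℤ) - 1))ᴴ * (R (-(n : ℤ)))ᴴ * R (-(n : ℤ)))
    (h3 : ∀ n : ℤ, R n * T n = E n * R n) :
    (∀ n : ℕ,
      (Matrix.fromBlocks (A n) 0 0 (C (-(n : ℤ) - 1)))ᴴ
          * (Matrix.fromBlocks (R ((n : ℤ) + 1)) 0 0 (R (-(n : ℤ) - 2)))ᴴ
          * Matrix.fromBlocks (R ((n : ℤ) + 1)) 0 0 (R (-(n : ℤ) - 2))
        = (Matrix.fromBlocks (R n) 0 0 (R (-(n : ℤ) - 1)))ᴴ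
            * Matrix.fromBlocks (R n) 0 0 (R (-(n : ℤ) - 1))
            * Matrix.fromBlocks (C ((n : ℤ) + 1)) 0 0 (A (-(n : ℤ) - 2)))
    ∧ (Matrix.fromBlocks (R 0) 0 0 (R (-1))
          * Matrix.fromBlocks (T 0) (A (-1)) (C 0) (T (-1))
        = Matrix.fromBlocks (E 0) (R 0 * A (-1) * (R (-1))⁻¹)
            (R (-1) * C 0 * (R 0)⁻¹) (E (-1))
          * Matrix.fromBlocks (R 0) 0 0 (R (-1)))
    ∧ (∀ n : ℕ,
        Matrix.fromBlocks (R ((n : ℤ) + 1)) 0 0 (R (-(n : ℤ) - 2))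
            * Matrix.fromBlocks (T ((n : ℤ) + 1)) 0 0 (T (-(n : ℤ) - 2))
          = Matrix.fromBlocks (E ((n : ℤ) + 1)) 0 0 (E (-(n : ℤ) - 2))
              * Matrix.fromBlocks (R ((n : ℤ) + 1)) 0 0 (R (-(n : ℤ) - 2)))
    ∧ (∀ n : ℕ, IsUnit (Matrix.fromBlocks (R n) 0 0 (R (-(n : ℤ) - 1))))
    ∧ (Matrix.fromBlocks (E 0) (R 0 * A (-1) * (R (-1))⁻¹)
          (R (-1) * C 0 * (R 0)⁻¹) (E (-1))).IsHermitian
    ∧ (∀ n : ℕ,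
        (Matrix.fromBlocks (E ((n : ℤ) + 1)) 0 0 (E (-(n : ℤ) - 2))).IsHermitian) := by
  have hdet : ∀ n : ℤ, IsUnit (R n).det := fun n => (Matrix.isUnit_iff_isUnit_det _).1 (hR n)
  have key : (R 0 * A (-1) * (R (-1))⁻¹)ᴴ = R (-1) * C 0 * (R 0)⁻¹ := by
    have h := h2 0
    simp only [Nat.cast_zero, neg_zero, zero_sub] at h
    have hd1 : IsUnit ((R (-1))ᴴ).det := by
      rw [Matrix.det_conjTranspose]
      exact (hdet (-1)).star
    have e1 : (A (-1))ᴴ * (R 0)ᴴ = (R (-1))ᴴ * (R (-1) * C 0 * (R 0)⁻¹) := by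
      calc (A (-1))ᴴ * (R 0)ᴴ = (A (-1))ᴴ * (R 0)ᴴ * R 0 * (R 0)⁻¹ :=
            (Matrix.mul_nonsing_inv_cancel_right _ _ (hdet 0)).symm
        _ = _ := by rw [← h]; simp only [Matrix.mul_assoc]
    rw [Matrix.conjTranspose_mul, Matrix.conjTranspose_mul, e1,
      Matrix.conjTranspose_nonsing_inv, Matrix.nonsing_inv_mul_cancel_left _ _ hd1]
  refine ⟨fun n => ?_, ?_, fun n => ?_, fun n => ?_, ?_, fun n => ?_⟩
  · have h := congrArg Matrix.conjTranspose (h2 (n + 1))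
    have e1 : -((n + 1 : ℕ) : ℤ) - 1 = -(n : ℤ) - 2 := by push_cast; ring
    have e2 : -((n + 1 : ℕ) : ℤ) = -(n : ℤ) - 1 := by push_cast; ring
    rw [e1, e2] at h
    simp only [Matrix.conjTranspose_mul, Matrix.conjTranspose_conjTranspose,
      ← Matrix.mul_assoc] at h
    simp [Matrix.fromBlocks_conjTranspose, Matrix.fromBlocks_multiply, h1 n, h]
  · simp [Matrix.fromBlocks_multiply, h3,
      Matrix.nonsing_inv_mul_cancel_right _ _ (hdet _)]
  · simp [Matrix.fromBlocks_multiply, h3]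
  · rw [Matrix.isUnit_iff_isUnit_det, Matrix.det_fromBlocks_zero₂₁]
    exact (hdet _).mul (hdet _)
  · refine Matrix.IsHermitian.fromBlocks (hE _) key (hE _)
  · exact Matrix.IsHermitian.fromBlocks (hE _) (by simp) (hE _)
end

section
/- Let A = [[1,0],[1,−1]], C = [[1,1],[0,−1]], and let ⌈X⌉ := X ⊗ X̄ denote the Kronecker product of a matrix with its entrywise conjugate. Let G_1 = −3I_4, G_0 = ½·[[−4,1,1,0],[1,−3,0,1],[1,0,−3,1],[0,1,1,−2]], G_2 = −½·[[2,1,1,0],[1,3,0,1],[1,0,3,1],[0,1,1,4]], and let L̂ be the 16×16 block tridiagonal matrix [[G_0, ⌈C⌉, 0, 0],[⌈A⌉, G_1, ⌈C⌉, 0],[0, ⌈A⌉, G_1, ⌈C⌉],[0, 0, ⌈A⌉, G_2]]. Then the characteristic polynomial of −L̂ is det(x·I_16 + L̂) = x²·(x² − 6x + 4)·(x² − 6x + 2)²·(x² − (7/2)x + 2)²·(x² − (11/2)x + 5)². In particular the eigenvalues of −L̂ are 0, 3±√5, 3±√7, (7±√17)/4, (11±√41)/4, where 3−√5 and 3+√5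 have multiplicity 1 and all the others have multiplicity 2. -/
open Matrix Kronecker

/-- `⌈X⌉ := X ⊗ X̄`, the Kronecker product of a `2×2` matrix with its entrywise
conjugate, reindexed to a `4×4` matrix with the row-stacking (row-major) order
`(i,j) ↦ 2i + j` of pairs. -/
noncomputable def corner (X : Matrix (Fin 2) (Fin 2) ℂ) : Matrix (Fin 4) (Fin 4) ℂ :=
  Matrix.reindex finProdFinEquiv finProdFinEquiv (X ⊗ₖ X.map (starRingEnd ℂ))

/-- The diagonal blocks `G_0, G_1, G_1, G_2` of the generator of Section 6.3. -/
noncomputable def diagBlocks : Fin 4 → Matrix (Fin 4) (Fin 4) ℂ :=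
  ![((2 : ℂ))⁻¹ • !![-4, 1, 1, 0; 1, -3, 0, 1; 1, 0, -3, 1; 0, 1, 1, -2],
    (-3 : ℂ) • (1 : Matrix (Fin 4) (Fin 4) ℂ),
    (-3 : ℂ) • (1 : Matrix (Fin 4) (Fin 4) ℂ),
    (-((2 : ℂ))⁻¹) • !![2, 1, 1, 0; 1, 3, 0, 1; 1, 0, 3, 1; 0, 1, 1, 4]]

/-- Columns: bases of the invariant planes of the generator. -/
def basisP : Matrix (Fin 16) (Fin 16) ℤ :=
  !![0, 1, 0, 4, 0, -6, 0, 4, 0, 0, 0, 2, 0, 0, 0, -2;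
    -1, 0, -1, -4, 0, 4, 0, -2, 0, 2, 0, 2, 0, -2, 0, -2;
    -1, 0, -1, -4, 0, 4, 0, -2, 0, -2, 0, 0, 0, 2, 0, 0;
    -1, 1, -1, 0, 0, -2, 0, 2, 0, 0, 0, -2, 0, 0, 0, 2;
    -1, 1, 1, 0, 0, -2, -1, -10, 0, 0, -1, -4, 0, 0, 1, 8;
    1, 0, -1, -4, 1, 8, 0, 2, 1, 4, 0, 0, -1, -8, 0, 0;
    1, 0, -1, -4, 1, 8, 0, 2, -1, -4, -1, -4, 1, 8, 1, 8;
    0, 1, 0, -4, 1, 6, -1, -8, 0, 0, 1, 4, 0, 0, -1, -8;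
    0, 1, 0, -4, -1, -6, 1, 8, 0, 0, -1, -4, 0, 0, -1, -8;
    -1, 0, 1, 4, 1, 8, 0, 2, -1, -4, -1, -4, -1, -8, -1, -8;
    -1, 0, 1, 4, 1, 8, 0, 2, 1, 4, 0, 0, 1, 8, 0, 0;
    -1, 1, 1, 0, 0, 2, 1, 10, 0, 0, 1, 4, 0, 0, 1, 8;
    -1, 1, -1, 0, 0, 2, 0, -2, 0, 0, 0, 2, 0, 0, 0, 2;
    1, 0, 1, 4, 0, 4, 0, -2, 0, -2, 0, 0, 0, -2, 0, 0;
    1, 0, 1, 4, 0, 4, 0, -2, 0, 2, 0, 2, 0, 2, 0, 2;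
    0, 1, 0, 4, 0, 6, 0, -4, 0, 0, 0, -2, 0, 0, 0, -2]

/-- `80` times the inverse of `basisP`. -/
def basisQ : Matrix (Fin 16) (Fin 16) ℤ :=
  !![4, -8, -8, -4, -4, 8, 8, 4, 4, -8, -8, -4, -4, 8, 8, 4;
    12, -4, -4, 8, 8, 4, 4, 12, 12, -4, -4, 8, 8, 4, 4, 12;
    -8, -4, -4, -12, 12, -4, -4, 8, 8, 4, 4, 12, -12, 4, 4, -8;
    3, -1, -1, 2, -2, -1, -1, -3, -3, 1, 1, -2, 2, 1, 1, 3;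
    -56, -128, -128, -184, -8, 16, 16, 8, -8, 16, 16, 8, 184, -128, -128, 56;
    4, 12, 12, 16, 0, 0, 0, 0, 0, 0, 0, 0, -16, 12, 12, -4;
    -128, -184, -184, -312, -24, 8, 8, -16, 16, 8, 8, 24, 312, -184, -184, 128;
    12, 16, 16, 28, 0, 0, 0, 0, 0, 0, 0, 0, -28, 16, 16, -12;
    16, -32, 48, -16, 8, 24, -16, -8, 8, -16, 24, -8, 16, 48, -32, -16;
    -4, 8, -12, 4, 0, 0, 0, 0, 0, 0, 0, 0, -4, -12, 8, 4;
    -32, -16, -16, 32, -16, -8, -8, 16, -16, -8, -8, 16, -32, -16, -16, 32;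
    8, 4, 4, -8, 0, 0, 0, 0, 0, 0, 0, 0, 8, 4, 4, -8;
    -32, 64, -96, 32, -8, -24, 16, 8, 8, -16, 24, -8, 32, 96, -64, -32;
    4, -8, 12, -4, 0, 0, 0, 0, 0, 0, 0, 0, -4, -12, 8, 4;
    64, 32, 32, -64, 16, 8, 8, -16, -16, -8, -8, 16, -64, -32, -32, 64;
    -8, -4, -4, 8, 0, 0, 0, 0, 0, 0, 0, 0, 8, 4, 4, -8]

def PZ : Matrix (Fin 4 × Fin 4) (Fin 2 × Fin 8) ℤ :=
  fun p q => basisP (finProdFinEquiv (m := 4) (n := 4) p) (finProdFinEquiv (m := 8) (n := 2) (q.2, q.1))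

def QZ : Matrix (Fin 2 × Fin 8) (Fin 4 × Fin 4) ℤ :=
  fun q p => basisQ (finProdFinEquiv (m := 8) (n := 2) (q.2, q.1)) (finProdFinEquiv (m := 4) (n := 4) p)

/-- The `2×2` diagonal blocks of `2L` in the new basis. -/
def blocksZ : Fin 8 → Matrix (Fin 2) (Fin 2) ℤ :=
  ![!![0, 0; 0, 0], !![0, 16; -1, -12], !![0, 8; -1, -12], !![0, 8; -1, -12], !![0, 8; -1, -7], !![0, 8; -1, -7], !![0, 20; -1, -11], !![0, 20; -1, -11]]

/-- Diagonal blocks of `2L`. -/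
def diagZ : Fin 4 → Matrix (Fin 4) (Fin 4) ℤ :=
  ![!![-4, 1, 1, 0; 1, -3, 0, 1; 1, 0, -3, 1; 0, 1, 1, -2],
    !![-6, 0, 0, 0; 0, -6, 0, 0; 0, 0, -6, 0; 0, 0, 0, -6],
    !![-6, 0, 0, 0; 0, -6, 0, 0; 0, 0, -6, 0; 0, 0, 0, -6],
    !![-2, -1, -1, 0; -1, -3, 0, -1; -1, 0, -3, -1; 0, -1, -1, -4]]

def cornerAZ : Matrix (Fin 4) (Fin 4) ℤ :=
  !![1, 0, 0, 0; 1, -1, 0, 0; 1, 0, -1, 0; 1, -1, -1, 1]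

def cornerCZ : Matrix (Fin 4) (Fin 4) ℤ :=
  !![1, 1, 1, 1; 0, -1, 0, -1; 0, 0, -1, -1; 0, 0, 0, 1]

/-- The integer matrix `2L`. -/
def LZ : Matrix (Fin 4 × Fin 4) (Fin 4 × Fin 4) ℤ := fun p q =>
  if p.1 = q.1 then diagZ p.1 p.2 q.2
  else if (p.1 : ℕ) = (q.1 : ℕ) + 1 then 2 * cornerAZ p.2 q.2
  else if (q.1 : ℕ) = (p.1 : ℕ) + 1 then 2 * cornerCZ p.2 q.2
  else 0

theorem PQ_eq : PZ * QZ = (80 : ℤ) • (1 : Matrix (Fin 4 × Fin 4) (Fin 4 × Fin 4) ℤ) := by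
  decide +kernel

theorem LP_eq : LZ * PZ = PZ * Matrix.blockDiagonal blocksZ := by
  decide +kernel

theorem corner_apply (X : Matrix (Fin 2) (Fin 2) ℂ) (i j : Fin 4) :
    corner X i j = X ((![0, 0, 1, 1] : Fin 4 → Fin 2) i) ((![0, 0, 1, 1] : Fin 4 → Fin 2) j)
      * starRingEnd ℂ (X ((![0, 1, 0, 1] : Fin 4 → Fin 2) i)
        ((![0, 1, 0, 1] : Fin 4 → Fin 2) j)) := by
  fin_cases i <;> fin_cases j <;> rfl

theorem cornerA_eq (i j : Fin 4) : corner !![1, 0; 1, -1] i j = (cornerAZ i j : ℂ) := by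
  fin_cases i <;> fin_cases j <;>
    simp [corner_apply, cornerAZ]

theorem cornerC_eq (i j : Fin 4) : corner !![1, 1; 0, -1] i j = (cornerCZ i j : ℂ) := by
  fin_cases i <;> fin_cases j <;>
    simp [corner_apply, cornerCZ]

theorem diag_eq0 (i j : Fin 4) : (2 : ℂ) * diagBlocks 0 i j = (diagZ 0 i j : ℂ) := by
  change (2 : ℂ) * ((2 : ℂ)⁻¹ * _) = _
  rw [mul_inv_cancel_left₀ two_ne_zero]
  fin_cases i <;> fin_cases j <;> simp [diagZ]

theorem diag_eq1 (i j : Fin 4) : (2 : ℂ) * diagBlocks 1 i j = (diagZ 1 i j : ℂ) := by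
  change (2 : ℂ) * ((-3 : ℂ) * (1 : Matrix (Fin 4) (Fin 4) ℂ) i j) = _
  rw [Matrix.one_apply]
  fin_cases i <;> fin_cases j <;> simp [diagZ] <;> norm_num

theorem diag_eq3 (i j : Fin 4) : (2 : ℂ) * diagBlocks 3 i j = (diagZ 3 i j : ℂ) := by
  change (2 : ℂ) * (-(2 : ℂ)⁻¹ * _) = _
  rw [neg_mul, mul_neg, mul_inv_cancel_left₀ two_ne_zero]
  fin_cases i <;> fin_cases j <;> simp [diagZ]

theorem diag_eq (b i j : Fin 4) : (2 : ℂ) * diagBlocks b i j = (diagZ b i j : ℂ) := by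
  fin_cases b
  · exact diag_eq0 i j
  · exact diag_eq1 i j
  · exact diag_eq1 i j
  · exact diag_eq3 i j

theorem det_of_LZ (L : Matrix (Fin 4 × Fin 4) (Fin 4 × Fin 4) ℂ)
    (h : (2 : ℂ) • L = LZ.map (Int.cast : ℤ → ℂ)) (x : ℂ) :
    (x • (1 : Matrix (Fin 4 × Fin 4) (Fin 4 × Fin 4) ℂ) + L).det
      = ∏ k, (x • (1 : Matrix (Fin 2) (Fin 2) ℂ)
          + (2 : ℂ)⁻¹ • (blocksZ k).map (Int.cast : ℤ → ℂ)).det := by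
  set P : Matrix (Fin 4 × Fin 4) (Fin 2 × Fin 8) ℂ := PZ.map (Int.castRingHom ℂ) with hP
  set Q : Matrix (Fin 2 × Fin 8) (Fin 4 × Fin 4) ℂ := QZ.map (Int.castRingHom ℂ) with hQ
  have hPQ : P * Q = (80 : ℂ) • 1 := by
    rw [hP, hQ, ← Matrix.map_mul, PQ_eq]
    ext i j
    rw [Matrix.map_apply, Matrix.smul_apply, Matrix.smul_apply, Matrix.one_apply, Matrix.one_apply]
    by_cases hij : i = j <;> simp only [hij, if_true, if_false] <;> simp
  set B : Matrix (Fin 2 × Fin 8) (Fin 2 × Fin 8) ℂ :=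
    Matrix.blockDiagonal fun k => (blocksZ k).map (Int.cast : ℤ → ℂ) with hB
  have hB2 : (Matrix.blockDiagonal blocksZ).map (Int.castRingHom ℂ) = B := by
    rw [Matrix.blockDiagonal_map _ _ (map_zero _)]
    rfl
  have hLP : ((2 : ℂ) • L) * P = P * B := by
    rw [h, hP, ← hB2, ← Matrix.map_mul, ← LP_eq, Matrix.map_mul]
    rfl
  have h1 : P * ((80 : ℂ)⁻¹ • Q) = 1 := by
    rw [Matrix.mul_smul, hPQ, smul_smul]; norm_num
  have h2 : ((80 : ℂ)⁻¹ • Q) * P = 1 := by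
    exact (Matrix.mul_eq_one_comm_of_card_eq _ _ _ (by simp)).mp h1
  have hL2 : L * P = P * ((2 : ℂ)⁻¹ • B) := by
    rw [Matrix.mul_smul, ← hLP, Matrix.smul_mul, smul_smul]; norm_num
  have key : x • (1 : Matrix (Fin 4 × Fin 4) (Fin 4 × Fin 4) ℂ) + L
      = P * (x • 1 + (2 : ℂ)⁻¹ • B) * ((80 : ℂ)⁻¹ • Q) := by
    rw [Matrix.mul_add, ← hL2, Matrix.mul_smul P x, Matrix.mul_one, Matrix.add_mul,
      Matrix.smul_mul x, h1, Matrix.mul_assoc, h1, Matrix.mul_one]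
  rw [key, Matrix.det_conj_of_mul_eq_one h1 h2, ← Matrix.det_blockDiagonal]
  congr 1
  rw [hB, ← Matrix.blockDiagonal_one, ← Matrix.blockDiagonal_smul, ← Matrix.blockDiagonal_smul,
    ← Matrix.blockDiagonal_add]
  rfl

theorem quad_iff (x a b s : ℂ) (hs : s ^ 2 = a ^ 2 - b) :
    x ^ 2 - 2 * a * x + b = 0 ↔ x = a - s ∨ x = a + s := by
  have : x ^ 2 - 2 * a * x + b = (x - (a - s)) * (x - (a + s)) := by
    linear_combination hs
  rw [this, mul_eq_zero, sub_eq_zero, sub_eq_zero]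

theorem sqrt_sq_complex (n : ℝ) (hn : 0 ≤ n) : ((Real.sqrt n : ℝ) : ℂ) ^ 2 = (n : ℂ) := by
  rw [← Complex.ofReal_pow, Real.sq_sqrt hn]

/-- **Section 6.3 (noncommuting transitions): spectral computation.**
With `A = [[1,0],[1,−1]]`, `C = [[1,1],[0,−1]]` and the `16×16` block tridiagonal
generator `L̂` with diagonal blocks `G_0, G_1, G_1, G_2`, subdiagonal blocks `⌈A⌉` and
superdiagonal blocks `⌈C⌉`, the characteristic polynomial of `−L̂` is
`det(xI + L̂) = x²(x²−6x+4)(x²−6x+2)²(x²−(7/2)x+2)²(x²−(11/2)x+5)²`; in particular the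
eigenvalues of `−L̂` are `0, 3±√5, 3±√7, (7±√17)/4, (11±√41)/4`. -/
theorem stmt14
    (L : Matrix (Fin 4 × Fin 4) (Fin 4 × Fin 4) ℂ)
    (hL : ∀ p q : Fin 4 × Fin 4,
      L p q = (if p.1 = q.1 then diagBlocks p.1
          else if (p.1 : ℕ) = (q.1 : ℕ) + 1 then corner !![1, 0; 1, -1]
          else if (q.1 : ℕ) = (p.1 : ℕ) + 1 then corner !![1, 1; 0, -1]
          else 0) p.2 q.2) :
    (∀ x : ℂ,
      (x • (1 : Matrix (Fin 4 × Fin 4) (Fin 4 × Fin 4) ℂ) + L).det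
        = x ^ 2 * (x ^ 2 - 6 * x + 4) * (x ^ 2 - 6 * x + 2) ^ 2
            * (x ^ 2 - (7 / 2) * x + 2) ^ 2 * (x ^ 2 - (11 / 2) * x + 5) ^ 2)
    ∧ (∀ x : ℂ, x ∈ spectrum ℂ (-L) ↔
        x ∈ ({0, ((3 - Real.sqrt 5 : ℝ) : ℂ), ((3 + Real.sqrt 5 : ℝ) : ℂ),
            ((3 - Real.sqrt 7 : ℝ) : ℂ), ((3 + Real.sqrt 7 : ℝ) : ℂ),
            (((7 - Real.sqrt 17) / 4 : ℝ) : ℂ), (((7 + Real.sqrt 17) / 4 : ℝ) : ℂ),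
            (((11 - Real.sqrt 41) / 4 : ℝ) : ℂ), (((11 + Real.sqrt 41) / 4 : ℝ) : ℂ)} : Set ℂ)) := by
  have h : (2 : ℂ) • L = LZ.map (Int.cast : ℤ → ℂ) := by
    ext p q
    rw [Matrix.smul_apply, hL, Matrix.map_apply, LZ, smul_eq_mul]
    split_ifs
    · exact diag_eq _ _ _
    · rw [cornerA_eq]; push_cast; rfl
    · rw [cornerC_eq]; push_cast; rfl
    · simp
  have hdet : ∀ x : ℂ,
      (x • (1 : Matrix (Fin 4 × Fin 4) (Fin 4 × Fin 4) ℂ) + L).det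
        = x ^ 2 * (x ^ 2 - 6 * x + 4) * (x ^ 2 - 6 * x + 2) ^ 2
            * (x ^ 2 - (7 / 2) * x + 2) ^ 2 * (x ^ 2 - (11 / 2) * x + 5) ^ 2 := by
    intro x
    rw [det_of_LZ L h]
    simp [Fin.prod_univ_succ, blocksZ, Matrix.det_fin_two]
    ring
  refine ⟨hdet, fun x => ?_⟩
  have h5 := sqrt_sq_complex 5 (by norm_num)
  have h7 := sqrt_sq_complex 7 (by norm_num)
  have h17 := sqrt_sq_complex 17 (by norm_num)
  have h41 := sqrt_sq_complex 41 (by norm_num)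
  push_cast at h5 h7 h17 h41
  have q5 := quad_iff x 3 4 (Real.sqrt 5 : ℝ) (by rw [h5]; norm_num)
  have q7 := quad_iff x 3 2 (Real.sqrt 7 : ℝ) (by rw [h7]; norm_num)
  have q17 := quad_iff x (7 / 4) 2 ((Real.sqrt 17 : ℝ) / 4) (by rw [div_pow, h17]; norm_num)
  have q41 := quad_iff x (11 / 4) 5 ((Real.sqrt 41 : ℝ) / 4) (by rw [div_pow, h41]; norm_num)
  rw [show (2 : ℂ) * 3 = 6 by norm_num] at q5 q7
  rw [show (2 : ℂ) * (7 / 4) = 7 / 2 by norm_num, ← sub_div, ← add_div] at q17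
  rw [show (2 : ℂ) * (11 / 4) = 11 / 2 by norm_num, ← sub_div, ← add_div] at q41
  rw [spectrum.mem_iff, Matrix.isUnit_iff_isUnit_det, isUnit_iff_ne_zero, not_not,
    Algebra.algebraMap_eq_smul_one, sub_neg_eq_add, hdet]
  simp only [mul_eq_zero, pow_eq_zero_iff (two_ne_zero), q5, q7, q17, q41,
    Set.mem_insert_iff, Set.mem_singleton_iff]
  push_cast
  simp only [or_assoc]
end

section
/- Let a, c > 0 with a ≠ c, and for z ∈ (−(a−c)², 0) define σ(z) = ( z − a² + c² + √((z + a² + c²)² − 4a²c²) ) / (2c²z) (the expression under the square root is strictly positive on this interval). If a < c then σ(z) → −∞ as z → 0⁻ (in particular |σ(z)| → ∞), while if a > c then σ(z) converges to a finite limit as z → 0⁻. -/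
open Filter Set

/-- **Section 6.1: recurrence classification for the half-line walk.**
For `a, c > 0` with `a ≠ c`, let
`σ(z) = (z − a² + c² + √((z + a² + c²)² − 4a²c²))/(2c²z)` for `z ∈ (−(a−c)², 0)` (the
radicand is strictly positive on this interval).  If `a < c` then `σ(z) → −∞` as
`z → 0⁻` (in particular `|σ(z)| → ∞`), while if `a > c` then `σ(z)` converges to a
finite limit as `z → 0⁻`. -/
theorem stmt17 (a c : ℝ) (ha : 0 < a) (hc : 0 < c) (hac : a ≠ c) :
    (∀ z ∈ Set.Ioo (-(a - c) ^ 2) (0 : ℝ),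
      0 < (z + a ^ 2 + c ^ 2) ^ 2 - 4 * a ^ 2 * c ^ 2)
    ∧ (a < c →
        Tendsto (fun z : ℝ =>
            (z - a ^ 2 + c ^ 2 + Real.sqrt ((z + a ^ 2 + c ^ 2) ^ 2 - 4 * a ^ 2 * c ^ 2))
              / (2 * c ^ 2 * z))
          (nhdsWithin 0 (Set.Iio 0)) atBot)
    ∧ (c < a →
        ∃ l : ℝ, Tendsto (fun z : ℝ =>
            (z - a ^ 2 + c ^ 2 + Real.sqrt ((z + a ^ 2 + c ^ 2) ^ 2 - 4 * a ^ 2 * c ^ 2))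
              / (2 * c ^ 2 * z))
          (nhdsWithin 0 (Set.Iio 0)) (nhds l)) := by
  have h0 : (0 + a ^ 2 + c ^ 2) ^ 2 - 4 * a ^ 2 * c ^ 2 = (a ^ 2 - c ^ 2) ^ 2 := by ring
  refine ⟨?_, ?_, ?_⟩
  · rintro z ⟨h1, h2⟩
    have h3 : 0 < z + a ^ 2 + c ^ 2 - 2 * a * c := by nlinarith
    have h4 : 0 < a * c := mul_pos ha hc
    have h5 : 0 < z + a ^ 2 + c ^ 2 + 2 * a * c := by nlinarith
    have := mul_pos h3 h5
    nlinarith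
  · intro h
    have hp : 0 < c ^ 2 - a ^ 2 := by nlinarith
    have hcont : Continuous (fun z : ℝ =>
        (z - a ^ 2 + c ^ 2 + Real.sqrt ((z + a ^ 2 + c ^ 2) ^ 2 - 4 * a ^ 2 * c ^ 2))
          / (2 * c ^ 2)) := by fun_prop
    have ht := (hcont.tendsto 0).mono_left (nhdsWithin_le_nhds (s := Set.Iio 0))
    have hpos : 0 < (0 - a ^ 2 + c ^ 2 +
        Real.sqrt ((0 + a ^ 2 + c ^ 2) ^ 2 - 4 * a ^ 2 * c ^ 2)) / (2 * c ^ 2) := by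
      apply div_pos _ (by positivity)
      have := Real.sqrt_nonneg ((0 + a ^ 2 + c ^ 2) ^ 2 - 4 * a ^ 2 * c ^ 2)
      linarith
    have := ht.pos_mul_atBot hpos tendsto_inv_nhdsLT_zero
    refine this.congr fun z => ?_
    rw [← div_eq_mul_inv, div_div]
  · intro h
    have hp : 0 < a ^ 2 - c ^ 2 := by nlinarith
    have hd : DifferentiableAt ℝ (fun z : ℝ =>
        (z - a ^ 2 + c ^ 2 + Real.sqrt ((z + a ^ 2 + c ^ 2) ^ 2 - 4 * a ^ 2 * c ^ 2))
          / (2 * c ^ 2)) 0 := by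
      have hs : DifferentiableAt ℝ (fun z : ℝ =>
          Real.sqrt ((z + a ^ 2 + c ^ 2) ^ 2 - 4 * a ^ 2 * c ^ 2)) 0 := by
        apply DifferentiableAt.sqrt (by fun_prop)
        rw [h0]
        positivity
      fun_prop
    have ht := hd.hasDerivAt.tendsto_slope
    refine ⟨_, (ht.mono_left (nhdsWithin_mono 0 (t := {0}ᶜ) ?_)).congr fun z => ?_⟩
    · exact fun z hz => ne_of_lt hz
    · rw [slope_def_field, h0, Real.sqrt_sq hp.le]
      have : (0 - a ^ 2 + c ^ 2 + (a ^ 2 - c ^ 2)) = 0 := by ring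
      rw [this, zero_div, sub_zero, sub_zero, div_div]
end
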